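/- Let (R, r) be a dévissage setup. (a) If n ≥ 1 and M is a projective R/rⁿR-module, then for every integer 0 ≤ k < n the surjective R/rR-linear map M/rM → rᵏM/rᵏ⁺¹M induced by multiplication by rᵏ is an isomorphism. (b) If M is a projective R-module, the same conclusion holds for every k ≥ 0. -/

import Mathlib

open Pointwise

universe u

section Core

variable {R : Type u} [CommRing R]

/-- A dévissage setup: `R` is `r`-torsion-free and `r`-adically complete and separated. -/
structure IsDevissageSetup (R : Type u) [CommRing R] (r : R) : Prop where
  torsionFree : ∀ x : R, r * x = 0 → x = 0
  adicComplete : IsAdicComplete (Ideal.span {r}) R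

/-- `Q` has constant rank over `A`: localization at every prime is free of a fixed rank. -/
def ConstRank (A : Type u) [CommRing A] (Q : Type u) [AddCommGroup Q] [Module A Q] : Prop :=
  ∃ c : ℕ, ∀ (p : Ideal A) (_ : p.IsPrime),
    Nonempty ((LocalizedModule p.primeCompl Q) ≃ₗ[Localization.AtPrime p]
      (Fin c → Localization.AtPrime p))

/-- finitely generated, projective, of constant rank -/
def FinProjConstRank (A : Type u) [CommRing A] (Q : Type u) [AddCommGroup Q] [Module A Q] : Prop :=
  Module.Finite A Q ∧ Module.Projective A Q ∧ ConstRank A Q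

/-- the subquotient `rⁿM/rⁿ⁺¹M`, realized as a submodule of `M/rⁿ⁺¹M`. -/
def muQuotSub (r : R) (M : Type u) [AddCommGroup M] [Module R M] (n : ℕ) :
    Submodule R (M ⧸ (r ^ (n + 1) • (⊤ : Submodule R M))) :=
  (r ^ n • (⊤ : Submodule R M)).map (r ^ (n + 1) • (⊤ : Submodule R M)).mkQ

theorem muQuotSub_isTorsionBySet (r : R) (M : Type u) [AddCommGroup M] [Module R M] (n : ℕ) :
    Module.IsTorsionBySet R (muQuotSub r M n) ((Ideal.span {r} : Ideal R) : Set R) := by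
  refine (Module.isTorsionBySet_span_singleton_iff r).mpr ?_
  rintro ⟨x, hx⟩
  obtain ⟨m, hm, rfl⟩ := hx
  obtain ⟨m', -, rfl⟩ := hm
  apply Subtype.ext
  show r • ((r ^ (n + 1) • (⊤ : Submodule R M)).mkQ
      ((DistribMulAction.toLinearMap R M (r ^ n) : M →ₗ[R] M) m')) = 0
  rw [← map_smul]
  rw [Submodule.mkQ_apply, Submodule.Quotient.mk_eq_zero]
  show r • r ^ n • m' ∈ r ^ (n + 1) • (⊤ : Submodule R M)
  rw [smul_smul, ← pow_succ']
  exact Submodule.smul_mem_pointwise_smul _ _ _ Submodule.mem_top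

/-- `M` has finite projective `(r,μ)`-dévissage. -/
def HasFinProjMuDevissage (r : R) (M : Type u) [AddCommGroup M] [Module R M] : Prop :=
  ∀ n : ℕ,
    letI := (muQuotSub_isTorsionBySet r M n).module
    FinProjConstRank (R ⧸ (Ideal.span {r} : Ideal R)) (muQuotSub r M n)

/-- `M` has bounded `r^∞`-torsion. -/
def BoundedRTorsion (r : R) (M : Type u) [AddCommGroup M] [Module R M] : Prop :=
  ∃ N : ℕ, 1 ≤ N ∧ ∀ x : M, (∃ k : ℕ, r ^ k • x = 0) → r ^ N • x = 0

end Core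

section MuMap

variable {R : Type u} [CommRing R]

/-- the map `M → rᵏM/rᵏ⁺¹M` induced by multiplication by `rᵏ`. -/
def muRestrict (r : R) (M : Type u) [AddCommGroup M] [Module R M] (k : ℕ) :
    M →ₗ[R] muQuotSub r M k :=
  LinearMap.codRestrict (muQuotSub r M k)
    ((r ^ (k + 1) • (⊤ : Submodule R M)).mkQ.comp (DistribMulAction.toLinearMap R M (r ^ k)))
    (fun m => Submodule.mem_map_of_mem
      (Submodule.smul_mem_pointwise_smul m (r ^ k) ⊤ Submodule.mem_top))

/-- the map `M/rM → rᵏM/rᵏ⁺¹M` induced by multiplication by `rᵏ`. -/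
def muMap (r : R) (M : Type u) [AddCommGroup M] [Module R M] (k : ℕ) :
    (M ⧸ (r • (⊤ : Submodule R M))) →ₗ[R] muQuotSub r M k :=
  Submodule.liftQ _ (muRestrict r M k) (by
    rintro x hx
    obtain ⟨m', -, rfl⟩ := hx
    rw [LinearMap.mem_ker]
    apply Subtype.ext
    show ((r ^ (k + 1) • (⊤ : Submodule R M)).mkQ (r ^ k • (r • m'))) = 0
    rw [Submodule.mkQ_apply, Submodule.Quotient.mk_eq_zero, smul_smul, ← pow_succ]
    exact Submodule.smul_mem_pointwise_smul _ _ _ Submodule.mem_top)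

end MuMap

theorem muMap_bijective_aux {R : Type u} [CommRing R] (r : R) (M : Type u) [AddCommGroup M]
    [Module R M] (k : ℕ) (H : ∀ z : M, r ^ k • z = 0 → z ∈ r • (⊤ : Submodule R M)) :
    Function.Bijective (muMap r M k) := by
  constructor
  · rw [injective_iff_map_eq_zero]
    intro x hx
    obtain ⟨x, rfl⟩ := Submodule.Quotient.mk_surjective _ x
    have h1 : (r ^ (k + 1) • (⊤ : Submodule R M)).mkQ (r ^ k • x) = 0 := congrArg Subtype.val hx
    rw [Submodule.mkQ_apply, Submodule.Quotient.mk_eq_zero] at h1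
    obtain ⟨y, -, hy⟩ := h1
    have hy' : r ^ (k + 1) • y = r ^ k • x := hy
    rw [Submodule.Quotient.mk_eq_zero]
    have h2 : x - r • y ∈ r • (⊤ : Submodule R M) := by
      apply H
      rw [smul_sub, smul_smul, ← pow_succ, hy', sub_self]
    have h3 : r • y ∈ r • (⊤ : Submodule R M) :=
      Submodule.smul_mem_pointwise_smul _ _ _ Submodule.mem_top
    simpa using Submodule.add_mem _ h2 h3
  · rintro ⟨x, hx⟩
    obtain ⟨m, ⟨m', -, rfl⟩, rfl⟩ := hx
    exact ⟨Submodule.Quotient.mk m', rfl⟩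

theorem mem_smul_top_of_projective_aux {R A : Type u} [CommRing R] [CommRing A] [Algebra R A]
    (r : R) (M : Type u) [AddCommGroup M] [Module R M] [Module A M] [IsScalarTower R A M]
    [Module.Projective A M] (k : ℕ) (H : ∀ a : A, r ^ k • a = 0 → ∃ b : A, a = r • b)
    (z : M) (hz : r ^ k • z = 0) : z ∈ r • (⊤ : Submodule R M) := by
  obtain ⟨s, hs⟩ := (Module.projective_def (R := A) (P := M)).mp inferInstance
  have h0 : r ^ k • s z = 0 := by
    rw [← algebraMap_smul A, ← map_smul, algebraMap_smul, hz, map_zero]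
  rw [← hs z, Finsupp.linearCombination_apply, Finsupp.sum]
  refine Submodule.sum_mem _ fun i _ => ?_
  obtain ⟨b, hb⟩ := H (s z i) (by rw [← Finsupp.smul_apply, h0, Finsupp.zero_apply])
  rw [hb, smul_assoc]
  exact Submodule.smul_mem_pointwise_smul _ _ _ Submodule.mem_top

/-- part of Lemma `lemma_pour_ko_1`: for a dévissage setup `(R,r)`:
(a) if `n ≥ 1` and `M` is a projective `R/rⁿR`-module then for all `k < n` the surjective
map `M/rM → rᵏM/rᵏ⁺¹M` induced by multiplication by `rᵏ` is an isomorphism;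
(b) the same holds for every `k` when `M` is a projective `R`-module. -/
theorem muMap_bijective_of_projective {R : Type u} [CommRing R] (r : R)
    (hR : IsDevissageSetup R r) :
    (∀ (n : ℕ), 1 ≤ n → ∀ (M : Type u) [AddCommGroup M] [Module R M],
      ∀ h : Module.IsTorsionBySet R M ((Ideal.span {r ^ n} : Ideal R) : Set R),
        (letI := h.module; Module.Projective (R ⧸ (Ideal.span {r ^ n} : Ideal R)) M) →
        ∀ k : ℕ, k < n → Function.Bijective (muMap r M k)) ∧
    (∀ (M : Type u) [AddCommGroup M] [Module R M],
      Module.Projective R M → ∀ k : ℕ, Function.Bijective (muMap r M k)) := by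
  have tf : ∀ (k : ℕ) (x : R), r ^ k * x = 0 → x = 0 := by
    intro k
    induction k with
    | zero => intro x hx; simpa using hx
    | succ k ih =>
      intro x hx
      exact hR.torsionFree x (ih _ (by rw [← mul_assoc, ← pow_succ, hx]))
  refine ⟨?_, ?_⟩
  · intro n hn M _ _ h hP k hk
    letI := h.module
    haveI : Module.Projective (R ⧸ (Ideal.span {r ^ n} : Ideal R)) M := hP
    haveI : IsScalarTower R (R ⧸ (Ideal.span {r ^ n} : Ideal R)) M := h.isScalarTower
    refine muMap_bijective_aux r M k fun z hz =>
      mem_smul_top_of_projective_aux (A := R ⧸ (Ideal.span {r ^ n} : Ideal R)) r M k ?_ z hz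
    intro a ha
    obtain ⟨a, rfl⟩ := Ideal.Quotient.mk_surjective a
    have ha' : Ideal.Quotient.mk (Ideal.span {r ^ n}) (r ^ k * a) = 0 := ha
    rw [Ideal.Quotient.eq_zero_iff_mem, Ideal.mem_span_singleton] at ha'
    obtain ⟨c, hc⟩ := ha'
    obtain ⟨d, rfl⟩ : ∃ d, n = k + 1 + d := ⟨n - (k + 1), by omega⟩
    refine ⟨Ideal.Quotient.mk _ (r ^ d * c), ?_⟩
    have : a = r * (r ^ d * c) := by
      rw [← sub_eq_zero]
      apply tf k
      rw [mul_sub, hc]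
      ring
    exact congrArg _ this
  · intro M _ _ hP k
    refine muMap_bijective_aux r M k fun z hz =>
      mem_smul_top_of_projective_aux (A := R) r M k ?_ z hz
    intro a ha
    exact ⟨0, by rw [smul_zero]; exact tf k a ha⟩
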